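/- For all integers p, q ≥ 1, the set {(a,v) ∈ ℂ² : a has exact period p under F_{a,v} and −a has exact period q under F_{a,v}} is finite and has exactly 3·d(q)·d(p) elements. -/

import Mathlib

open Function Set

/-- The monic centered cubic polynomial `F_{a,v}(z) = z³ − 3a²z + (2a³ + v)`. -/
noncomputable def Fav (a v : ℂ) : ℂ → ℂ := fun z => z ^ 3 - 3 * a ^ 2 * z + (2 * a ^ 3 + v)

/-- `z` has exact period `p ≥ 1` under `F`. -/
def HasExactPeriod (F : ℂ → ℂ) (z : ℂ) (p : ℕ) : Prop :=
  F^[p] z = z ∧ ∀ j, 0 < j → j < p → F^[j] z ≠ z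

section Box

/-- The monomials not divisible by the leading monomials `X₀ ^ M` and `X₁ ^ N`. -/
def exponentBox (M N : ℕ) : Set (Fin 2 →₀ ℕ) := {c | c 0 < M ∧ c 1 < N}

theorem natCard_exponentBox (M N : ℕ) : Nat.card (exponentBox M N) = M * N := by
  have e : exponentBox M N ≃ Fin M × Fin N :=
    { toFun := fun c => (⟨c.1 0, c.2.1⟩, ⟨c.1 1, c.2.2⟩)
      invFun := fun x => ⟨Finsupp.equivFunOnFinite.symm ![x.1, x.2], by simp [exponentBox]⟩
      left_inv := fun c => by
        ext i
        fin_cases i <;> simp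
      right_inv := fun x => by simp }
  rw [Nat.card_congr e]
  simp

variable {K : Type*} [Field K] {m : MonomialOrder (Fin 2)} {P Q : MvPolynomial (Fin 2) K} {M N : ℕ}

open MvPolynomial

theorem restrictSupport_exponentBox_disjoint
    (hP : m.degree P = Finsupp.single 0 M) (hQ : m.degree Q = Finsupp.single 1 N)
    (hP0 : P ≠ 0) (hQ0 : Q ≠ 0) {r : MvPolynomial (Fin 2) K}
    (hr : r ∈ restrictSupport K (exponentBox M N)) (hI : r ∈ Ideal.span {P, Q}) : r = 0 := by
  obtain ⟨f, g, hfg⟩ := Ideal.mem_span_pair.1 hI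
  obtain ⟨f', f'', hf, -, hf''⟩ := m.div_single (b := Q)
    (by simpa using hQ0) f
  have hr' : r = f'' * P + (f' * P + g) * Q := by rw [← hfg, hf]; ring
  set g' := f' * P + g
  by_contra hr0
  have hmem : m.degree r ∈ exponentBox M N := hr (m.degree_mem_support hr0)
  have hdeg1 : f'' ≠ 0 → (m.degree (f'' * P) 0 ≥ M ∧ m.degree (f'' * P) 1 < N) := by
    intro h
    have := hf'' _ (m.degree_mem_support h)
    rw [hQ, Finsupp.single_le_iff, not_le] at this
    rw [m.degree_mul h hP0, hP]
    simpa using this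
  have hdeg2 : g' ≠ 0 → m.degree (g' * Q) 1 ≥ N := by
    intro h
    rw [m.degree_mul h hQ0, hQ]
    simp
  by_cases h1 : f'' = 0
  · by_cases h2 : g' = 0
    · simp [hr', h1, h2] at hr0
    · have := hdeg2 h2
      simp only [hr', h1, zero_mul, zero_add] at hmem
      exact absurd hmem.2 (by omega)
  · by_cases h2 : g' = 0
    · have := hdeg1 h1
      simp only [hr', h2, zero_mul, add_zero] at hmem
      exact absurd hmem.1 (by omega)
    · have h3 := hdeg1 h1
      have h4 := hdeg2 h2
      have hne : m.degree (f'' * P) ≠ m.degree (g' * Q) := fun h => by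
        rw [h] at h3
        omega
      have h5 := m.degree_add_of_ne hne
      rw [← hr'] at h5
      rcases max_choice (m.toSyn (m.degree (f'' * P))) (m.toSyn (m.degree (g' * Q))) with h | h
      · rw [h, EmbeddingLike.apply_eq_iff_eq] at h5
        rw [h5] at hmem
        exact absurd hmem.1 (by omega)
      · rw [h, EmbeddingLike.apply_eq_iff_eq] at h5
        rw [h5] at hmem
        exact absurd hmem.2 (by omega)

theorem exists_restrictSupport_exponentBox_sub_mem
    (hP : m.degree P = Finsupp.single 0 M) (hQ : m.degree Q = Finsupp.single 1 N)
    (hP0 : P ≠ 0) (hQ0 : Q ≠ 0) (f : MvPolynomial (Fin 2) K) :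
    ∃ r ∈ restrictSupport K (exponentBox M N), f - r ∈ Ideal.span {P, Q} := by
  obtain ⟨g, r, hf, -, hr⟩ := m.div_set (B := {P, Q}) (by simp [hP0, hQ0]) f
  refine ⟨r, fun c hc => ?_, ?_⟩
  · have h1 := hr c hc P (by simp)
    have h2 := hr c hc Q (by simp)
    rw [hP, Finsupp.single_le_iff, not_le] at h1
    rw [hQ, Finsupp.single_le_iff, not_le] at h2
    exact ⟨h1, h2⟩
  · rw [hf, add_sub_cancel_right, Finsupp.linearCombination_apply]
    exact Submodule.sum_mem _ fun b _ => Ideal.mul_mem_left _ _ (Ideal.subset_span b.2)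

/-- Bézout's theorem in the form of a dimension count: two plane curves whose leading monomials
are powers of the two distinct variables. -/
theorem finite_and_finrank_quotient_span_pair
    (hP : m.degree P = Finsupp.single 0 M) (hQ : m.degree Q = Finsupp.single 1 N)
    (hP0 : P ≠ 0) (hQ0 : Q ≠ 0) (hM : 0 < M) (hN : 0 < N) :
    Module.Finite K (MvPolynomial (Fin 2) K ⧸ Ideal.span {P, Q}) ∧
      Module.finrank K (MvPolynomial (Fin 2) K ⧸ Ideal.span {P, Q}) = M * N := by
  let φ : restrictSupport K (exponentBox M N) →ₗ[K] MvPolynomial (Fin 2) K ⧸ Ideal.span {P, Q} :=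
    (Ideal.Quotient.mkₐ K (Ideal.span {P, Q})).toLinearMap ∘ₗ Submodule.subtype _
  have hφ : Function.Bijective φ := by
    constructor
    · rw [← LinearMap.ker_eq_bot, LinearMap.ker_eq_bot']
      intro r hr
      exact Subtype.ext (restrictSupport_exponentBox_disjoint hP hQ hP0 hQ0 r.2
        (Ideal.Quotient.eq_zero_iff_mem.1 hr))
    · intro x
      obtain ⟨f, rfl⟩ := Ideal.Quotient.mk_surjective x
      obtain ⟨r, hr, hfr⟩ := exists_restrictSupport_exponentBox_sub_mem hP hQ hP0 hQ0 f
      exact ⟨⟨r, hr⟩, (Ideal.Quotient.eq.2 hfr).symm⟩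
  have hcard := natCard_exponentBox M N
  have : Finite (exponentBox M N) := Nat.finite_of_card_ne_zero (by rw [hcard]; positivity)
  let b := (basisRestrictSupport K (exponentBox M N)).map (LinearEquiv.ofBijective φ hφ)
  exact ⟨Module.Finite.of_basis b, by rw [Module.finrank_eq_nat_card_basis b, hcard]⟩

end Box

/-- The map `z ↦ z³ - 3a²z + (2a³ + v)` over an arbitrary ring. -/
def cubicMap {A : Type*} [CommRing A] (a v z : A) : A := z ^ 3 - 3 * a ^ 2 * z + (2 * a ^ 3 + v)

section CubicMap

variable {A : Type*} [CommRing A] (a v : A)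

theorem cubicMap_self : cubicMap a v a = v := by
  unfold cubicMap; ring

theorem cubicMap_neg_self : cubicMap a v (-a) = 4 * a ^ 3 + v := by
  unfold cubicMap; ring

theorem map_iterate_cubicMap {B F : Type*} [CommRing B] [FunLike F A B] [RingHomClass F A B]
    (φ : F) (n : ℕ) (z : A) :
    φ ((cubicMap a v)^[n] z) = (cubicMap (φ a) (φ v))^[n] (φ z) := by
  induction n with
  | zero => rfl
  | succ n ih =>
    rw [Function.iterate_succ_apply', Function.iterate_succ_apply', ← ih]
    simp [cubicMap, map_ofNat]

theorem derivation_cubicMap {R M : Type*} [CommRing R] [Algebra R A] [AddCommGroup M] [Module A M]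
    [Module R M] (D : Derivation R A M) (z : A) :
    D (cubicMap a v z) =
      (3 * (z ^ 2 - a ^ 2)) • D z + (3 * (2 * a ^ 2 - 2 * a * z)) • D a + D v := by
  have h (n : ℕ) [n.AtLeastTwo] : D (OfNat.ofNat n : A) = 0 := by
    rw [← Nat.cast_ofNat]; exact D.map_natCast _
  simp only [cubicMap, map_add, map_sub, Derivation.leibniz, Derivation.leibniz_pow, h]
  simp only [← Nat.cast_smul_eq_nsmul A, smul_smul, smul_zero, add_zero]
  push_cast
  module

theorem iterate_cubicMap_mem {S : Subring A} (ha : a ∈ S) (hv : v ∈ S) {z : A} (hz : z ∈ S)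
    (n : ℕ) : (cubicMap a v)^[n] z ∈ S := by
  induction n with
  | zero => exact hz
  | succ n ih =>
    rw [Function.iterate_succ_apply']
    exact add_mem (sub_mem (pow_mem ih 3) (mul_mem (mul_mem (ofNat_mem S 3) (pow_mem ha 2)) ih))
      (add_mem (mul_mem (ofNat_mem S 2) (pow_mem ha 3)) hv)

/-- Modulo `3`, the derivative of any iterate of a cubic in this family is that of `v`. -/
theorem exists_derivation_iterate_cubicMap {R M : Type*} [CommRing R] [Algebra R A]
    [AddCommGroup M] [Module A M] [Module R M] (D : Derivation R A M) {S : Subring A}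
    (ha : a ∈ S) (hv : v ∈ S) {z s : A} (hz : z ∈ S) (hs : s ∈ S) (hD : D z = s • D a) (n : ℕ) :
    ∃ α ∈ S, ∃ β ∈ S,
      D ((cubicMap a v)^[n + 1] z) = (3 * α) • D a + (1 + 3 * β) • D v := by
  have key (y μ ν : A) (hy : y ∈ S) (hμ : μ ∈ S) (hν : ν ∈ S) (h : D y = μ • D a + ν • D v) :
      ∃ α ∈ S, ∃ β ∈ S, D (cubicMap a v y) = (3 * α) • D a + (1 + 3 * β) • D v := by
    have h1 : y ^ 2 - a ^ 2 ∈ S := sub_mem (pow_mem hy 2) (pow_mem ha 2)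
    refine ⟨(y ^ 2 - a ^ 2) * μ + (2 * a ^ 2 - 2 * a * y), add_mem (mul_mem h1 hμ)
      (sub_mem (mul_mem (ofNat_mem S 2) (pow_mem ha 2))
        (mul_mem (mul_mem (ofNat_mem S 2) ha) hy)), (y ^ 2 - a ^ 2) * ν, mul_mem h1 hν, ?_⟩
    rw [derivation_cubicMap, h]
    module
  induction n with
  | zero => exact key z s 0 hz hs (zero_mem S) (by simp [hD])
  | succ n ih =>
    obtain ⟨α, hα, β, hβ, h⟩ := ih
    rw [Function.iterate_succ_apply']
    exact key _ _ _ (iterate_cubicMap_mem a v ha hv hz _) (mul_mem (ofNat_mem S 3) hα)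
      (add_mem (one_mem S) (mul_mem (ofNat_mem S 3) hβ)) h

end CubicMap

section Degree

open MvPolynomial MonomialOrder

variable {σ K : Type*} [Field K] (m : MonomialOrder σ)

theorem MonomialOrder.degree_add_lt {f g : MvPolynomial σ K} {D : m.syn}
    (hf : m.toSyn (m.degree f) < D) (hg : m.toSyn (m.degree g) < D) :
    m.toSyn (m.degree (f + g)) < D :=
  m.degree_add_le.trans_lt (max_lt hf hg)

theorem MonomialOrder.degree_C_mul_le (c : K) (f : MvPolynomial σ K) :
    m.toSyn (m.degree (C c * f)) ≤ m.toSyn (m.degree f) := by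
  rw [← smul_eq_C_mul]
  exact m.degree_smul_le

theorem degree_cubicMap {a v z : MvPolynomial σ K} (ha : m.degree a ≺[m] m.degree z)
    (hv : m.degree v ≼[m] m.degree z) :
    m.degree (cubicMap a v z) = 3 • m.degree z := by
  have hz : 0 < m.toSyn (m.degree z) := (m.zero_le _).trans_lt ha
  have h3 : m.degree (z ^ 3) = 3 • m.degree z := m.degree_pow z 3
  have e : cubicMap a v z = z ^ 3 + (C (-3) * (a ^ 2 * z) + (C 2 * a ^ 3 + v)) := by
    simp only [cubicMap, map_neg, map_ofNat]; ring
  rw [e, m.degree_add_of_lt, h3]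
  rw [h3, map_nsmul]
  set s := m.toSyn (m.degree z) with hs
  set t := m.toSyn (m.degree a) with ht
  have h1 : s < 3 • s := by
    simpa using nsmul_lt_nsmul_left hz (show 1 < 3 by norm_num)
  refine m.degree_add_lt ((m.degree_C_mul_le _ _).trans_lt ?_)
    (m.degree_add_lt ((m.degree_C_mul_le _ _).trans_lt ?_) (hv.trans_lt h1))
  · refine m.degree_mul_le.trans_lt ?_
    rw [map_add, m.degree_pow, map_nsmul, ← hs, ← ht, succ_nsmul s 2]
    gcongr
  · rw [m.degree_pow, map_nsmul, ← ht]
    exact nsmul_lt_nsmul_right three_ne_zero ha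

theorem degree_iterate_cubicMap {a v z : MvPolynomial σ K} (ha : m.degree a ≺[m] m.degree z)
    (hv : m.degree v ≼[m] m.degree z) (n : ℕ) :
    m.degree ((cubicMap a v)^[n] z) = 3 ^ n • m.degree z := by
  induction n with
  | zero => simp
  | succ n ih =>
    have hle : m.degree z ≼[m] 3 ^ n • m.degree z := by
      rw [map_nsmul]
      exact le_self_nsmul (m.zero_le _) (by positivity)
    rw [Function.iterate_succ_apply', degree_cubicMap m, ih, smul_smul, pow_succ']
    · rw [ih]; exact ha.trans_le hle
    · rw [ih]; exact hv.trans hle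

theorem degree_iterate_cubicMap_sub_and_ne_zero {a v z y : MvPolynomial σ K}
    (ha : m.degree a ≺[m] m.degree z) (hv : m.degree v ≼[m] m.degree z)
    (hy : m.degree y ≼[m] m.degree a) (n : ℕ) :
    m.degree ((cubicMap a v)^[n] z - y) = 3 ^ n • m.degree z ∧ (cubicMap a v)^[n] z - y ≠ 0 := by
  have hd := degree_iterate_cubicMap m ha hv n
  have hle : m.degree z ≼[m] 3 ^ n • m.degree z := by
    rw [map_nsmul]
    exact le_self_nsmul (m.zero_le _) (by positivity)
  have hlt : m.degree (-y) ≺[m] m.degree ((cubicMap a v)^[n] z) := by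
    rw [m.degree_neg, hd]
    exact hy.trans_lt (ha.trans_le hle)
  have h : m.degree ((cubicMap a v)^[n] z - y) = 3 ^ n • m.degree z := by
    rw [sub_eq_add_neg, m.degree_add_of_lt hlt, hd]
  refine ⟨h, fun h0 => ?_⟩
  rw [h0, m.degree_zero] at h
  rw [← h, map_zero] at hle
  exact absurd ((m.zero_le _).trans_lt ha) hle.not_gt

end Degree

section Valuation

variable {K Γ : Type*} [Field K] [LinearOrderedCommGroupWithZero Γ] (w : Valuation K Γ)

theorem valuation_cubicMap {a v z : K} (h2 : w 2 ≤ 1) (h3 : w 3 ≤ 1) (hz : 1 < w z)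
    (ha : w a < w z) (hv : w v ≤ w z) : w (cubicMap a v z) = w z ^ 3 := by
  have h0 : 0 < w z := zero_lt_one.trans hz
  have e : cubicMap a v z = (-(3 * (a ^ 2 * z)) + (2 * a ^ 3 + v)) + z ^ 3 := by
    unfold cubicMap; ring
  rw [e, Valuation.map_add_eq_of_lt_right, map_pow]
  rw [map_pow]
  refine w.map_add_lt ?_ (w.map_add_lt ?_ ?_)
  · rw [Valuation.map_neg, map_mul, map_mul, map_pow]
    calc w 3 * (w a ^ 2 * w z) ≤ 1 * (w a ^ 2 * w z) := by gcongr
      _ = w a ^ 2 * w z := one_mul _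
      _ < w z ^ 2 * w z := by gcongr; exact zero_le
      _ = w z ^ 3 := (pow_succ _ 2).symm
  · rw [map_mul, map_pow]
    calc w 2 * w a ^ 3 ≤ 1 * w a ^ 3 := by gcongr
      _ = w a ^ 3 := one_mul _
      _ < w z ^ 3 := by gcongr; exact zero_le
  · exact hv.trans_lt (lt_self_pow₀ hz (by norm_num))

theorem valuation_le_valuation_iterate_cubicMap {a v z : K} (h2 : w 2 ≤ 1) (h3 : w 3 ≤ 1)
    (hz : 1 < w z) (ha : w a < w z) (hv : w v ≤ w z) (n : ℕ) :
    w z ≤ w ((cubicMap a v)^[n] z) := by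
  induction n with
  | zero => rfl
  | succ n ih =>
    rw [Function.iterate_succ_apply', valuation_cubicMap w h2 h3 (hz.trans_le ih)
      (ha.trans_le ih) (hv.trans ih)]
    exact ih.trans (le_self_pow₀ (hz.le.trans ih) (by norm_num))

/-- If both critical points are periodic then `a` and `v` are integral away from `2`. -/
theorem valuation_le_one_of_iterate_cubicMap_eq {a v : K} (h2 : w 2 = 1) (h3 : w 3 ≤ 1) {k l : ℕ}
    (hp : (cubicMap a v)^[k + 1] a = a) (hq : (cubicMap a v)^[l + 1] (-a) = -a) :
    w a ≤ 1 ∧ w v ≤ 1 := by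
  rw [Function.iterate_succ_apply, cubicMap_self] at hp
  rw [Function.iterate_succ_apply, cubicMap_neg_self] at hq
  by_contra hcon
  rcases lt_or_ge (w a) (w v) with hav | hva
  · have hv1 : 1 < w v := by
      by_contra hv1
      exact hcon ⟨hav.le.trans (not_lt.1 hv1), not_lt.1 hv1⟩
    have := valuation_le_valuation_iterate_cubicMap w h2.le h3 hv1 hav le_rfl k
    rw [hp] at this
    exact absurd hav this.not_gt
  · have ha1 : 1 < w a := by
      by_contra ha1
      exact hcon ⟨not_lt.1 ha1, hva.trans (not_lt.1 ha1)⟩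
    have hlt : w a < w a ^ 3 := lt_self_pow₀ ha1 (by norm_num)
    have h4 : w (4 * a ^ 3) = w a ^ 3 := by
      rw [show (4 : K) = 2 * 2 by norm_num, map_mul, map_mul, map_pow, h2, one_mul, one_mul]
    have hz : w (4 * a ^ 3 + v) = w a ^ 3 := by
      rw [Valuation.map_add_eq_of_lt_left, h4]
      rw [h4]; exact hva.trans_lt hlt
    have := valuation_le_valuation_iterate_cubicMap w (a := a) (v := v) (z := 4 * a ^ 3 + v)
      h2.le h3 (by rw [hz]; exact ha1.trans hlt)
      (by rw [hz]; exact hlt) (by rw [hz]; exact hva.trans hlt.le) l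
    rw [hq, hz, Valuation.map_neg] at this
    exact absurd hlt this.not_gt

end Valuation

theorem exists_valuationSubring_three_mem_nonunits (K : Type*) [Field K] [CharZero K] :
    ∃ V : ValuationSubring K, (3 : K) ∈ V.nonunits := by
  let A : Subring K := (Int.castRingHom K).range
  let I : Ideal A := Ideal.span {3}
  have hI : I ≠ ⊤ := by
    rw [Ne, Ideal.span_singleton_eq_top, isUnit_iff_exists_inv]
    rintro ⟨⟨_, n, rfl⟩, h⟩
    have h' := congrArg Subtype.val h
    have h'' : (3 : K) * (n : K) = 1 := h'
    have : (3 : ℤ) * n = 1 := by exact_mod_cast h''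
    omega
  obtain ⟨V, -, hV⟩ := Ideal.image_subset_nonunits_valuationSubring I hI
  exact ⟨V, hV ⟨3, Ideal.subset_span rfl, rfl⟩⟩

section FiniteAlgebra

universe u

variable {K A : Type u} [Field K] [IsAlgClosed K] [CommRing A] [Algebra K A] [Module.Finite K A]

theorem isUnit_of_forall_algHom_ne_zero {x : A} (h : ∀ φ : A →ₐ[K] K, φ x ≠ 0) : IsUnit x := by
  by_contra hx
  obtain ⟨M, hM, hxM⟩ := exists_max_ideal_of_mem_nonunits hx
  let e := AlgEquiv.ofBijective (Algebra.ofId K (A ⧸ M))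
    IsAlgClosed.algebraMap_bijective_of_isIntegral
  refine h (e.symm.toAlgHom.comp (Ideal.Quotient.mkₐ K M)) ?_
  simp [Ideal.Quotient.eq_zero_iff_mem.2 hxM]

theorem natCard_algHom_eq_finrank [Algebra.FormallyUnramified K A] :
    Nat.card (A →ₐ[K] K) = Module.finrank K A := by
  have : Algebra.FormallyEtale K A := Algebra.FormallyEtale.of_formallyUnramified_of_field K A
  have : IsArtinianRing A := isArtinian_of_tower K inferInstance
  apply le_antisymm
  · have := Fintype.ofFinite (A →ₐ[K] K)
    rw [Nat.card_eq_fintype_card, ← Module.finrank_linearMap_self K K A]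
    exact (linearIndependent_toLinearMap K A K).fintype_card_le_finrank
  · let e := Algebra.FormallyEtale.equivPiOfIsSepClosed K A
    have := Fintype.ofFinite (PrimeSpectrum A)
    rw [e.toLinearEquiv.finrank_eq, Module.finrank_fintype_fun_eq_card,
      ← Nat.card_eq_fintype_card]
    refine Nat.card_le_card_of_injective
      (fun p => (Pi.evalAlgHom K (fun _ : PrimeSpectrum A => K) p).comp e.toAlgHom) ?_
    intro p p' h
    classical
    have := DFunLike.congr_fun h (e.symm (Pi.single p 1))
    by_contra hne
    simp [Ne.symm hne] at this

theorem formallyUnramified_of_iterate_cubicMap_eq [CharZero K] {a v : A}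
    (hgen : Algebra.adjoin K {a, v} = ⊤) {k l : ℕ}
    (hp : (cubicMap a v)^[k + 1] a = a) (hq : (cubicMap a v)^[l + 1] (-a) = -a) :
    Algebra.FormallyUnramified K A := by
  let D := KaehlerDifferential.D K A
  let S : Subring A := Subring.closure {a, v}
  have ha : a ∈ S := Subring.subset_closure (by simp)
  have hv : v ∈ S := Subring.subset_closure (by simp)
  obtain ⟨α, hα, β, hβ, h⟩ := exists_derivation_iterate_cubicMap a v D ha hv ha (one_mem S)
    (one_smul _ _).symm k
  obtain ⟨α', hα', β', hβ', h'⟩ := exists_derivation_iterate_cubicMap a v D ha hv (neg_mem ha)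
    (neg_mem (one_mem S)) (by simp) l
  rw [hp] at h
  rw [hq, map_neg] at h'
  have hJ : IsUnit ((3 * α - 1) * (1 + 3 * β') - (3 * α' + 1) * (1 + 3 * β)) := by
    refine isUnit_of_forall_algHom_ne_zero (K := K) fun φ hφ => ?_
    obtain ⟨V, hV⟩ := exists_valuationSubring_three_mem_nonunits K
    rw [V.mem_nonunits_iff] at hV
    have h2 : V.valuation 2 = 1 := by
      have : (2 : K) = 3 + (-1) := by norm_num
      rw [this, Valuation.map_add_eq_of_lt_right, Valuation.map_neg, map_one]
      rwa [Valuation.map_neg, map_one]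
    obtain ⟨ha1, hv1⟩ := valuation_le_one_of_iterate_cubicMap_eq V.valuation (a := φ a) (v := φ v)
      (k := k) (l := l) h2 hV.le (by rw [← map_iterate_cubicMap, hp])
      (by rw [← map_neg, ← map_iterate_cubicMap, hq])
    have hS : S ≤ V.toSubring.comap (φ : A →+* K) := by
      rw [Subring.closure_le]
      rintro x (rfl | rfl)
      · exact (V.valuation_le_one_iff _).1 ha1
      · exact (V.valuation_le_one_iff _).1 hv1
    let γ := 3 * α * β' - β' + α - 3 * α' * β - α' - β
    have hγ : γ ∈ S :=
      sub_mem (sub_mem (sub_mem (add_mem (sub_mem (mul_mem (mul_mem (ofNat_mem S 3) hα) hβ') hβ')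
        hα) (mul_mem (mul_mem (ofNat_mem S 3) hα') hβ)) hα') hβ
    have hγ1 : V.valuation (φ γ) ≤ 1 := (V.valuation_le_one_iff _).2 (hS hγ)
    have e : (3 * α - 1) * (1 + 3 * β') - (3 * α' + 1) * (1 + 3 * β) = 3 * γ - 2 := by
      simp only [γ]; ring
    rw [e, map_sub, map_mul, map_ofNat, map_ofNat, sub_eq_zero] at hφ
    have := congrArg V.valuation hφ
    rw [map_mul, h2] at this
    exact absurd this (mul_lt_one_of_lt_of_le hV hγ1).ne
  have e1 : (3 * α - 1) • D a + (1 + 3 * β) • D v = 0 := by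
    rw [sub_smul, one_smul, sub_add_eq_add_sub, ← h, sub_self]
  have e2 : (3 * α' + 1) • D a + (1 + 3 * β') • D v = 0 := by
    rw [add_smul, one_smul, add_right_comm, ← h', neg_add_cancel]
  have hDa : D a = 0 := by
    rw [← hJ.smul_eq_zero]
    calc _ = (1 + 3 * β') • ((3 * α - 1) • D a + (1 + 3 * β) • D v) -
          (1 + 3 * β) • ((3 * α' + 1) • D a + (1 + 3 * β') • D v) := by module
      _ = 0 := by rw [e1, e2, smul_zero, smul_zero, sub_zero]
  have hDv : D v = 0 := by
    rw [← hJ.smul_eq_zero]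
    calc _ = (3 * α - 1) • ((3 * α' + 1) • D a + (1 + 3 * β') • D v) -
          (3 * α' + 1) • ((3 * α - 1) • D a + (1 + 3 * β) • D v) := by module
      _ = 0 := by rw [e1, e2, smul_zero, smul_zero, sub_zero]
  have hD0 : D = 0 := by
    refine Derivation.ext_of_adjoin_eq_top {a, v} hgen ?_
    rintro x (rfl | rfl)
    · exact hDa
    · exact hDv
  constructor
  rw [← Submodule.subsingleton_iff A, ← subsingleton_iff_bot_eq_top,
    ← KaehlerDifferential.span_range_derivation, eq_comm, Submodule.span_eq_bot]
  rintro _ ⟨x, rfl⟩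
  exact DFunLike.congr_fun hD0 x

end FiniteAlgebra

section Count

open MvPolynomial

variable (K : Type*) [Field K]

/-- The parameters for which `a` is fixed by the `p`-th iterate and `-a` by the `q`-th iterate. -/
def periodicParameters (p q : ℕ) : Set (K × K) :=
  {w | (cubicMap w.1 w.2)^[p] w.1 = w.1 ∧ (cubicMap w.1 w.2)^[q] (-w.1) = -w.1}

/-- The ideal of `periodicParameters`, with variables `X 0 = v` and `X 1 = a`. -/
noncomputable def periodicIdeal (p q : ℕ) : Ideal (MvPolynomial (Fin 2) K) :=
  Ideal.span {(cubicMap (X 1) (X 0))^[p] (X 1) - X 1, (cubicMap (X 1) (X 0))^[q] (-X 1) - -X 1}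

/-- The coordinate ring of `periodicParameters`. -/
abbrev PeriodicRing (p q : ℕ) : Type _ := MvPolynomial (Fin 2) K ⧸ periodicIdeal K p q

theorem finite_and_finrank_periodicRing [CharZero K] (k l : ℕ) :
    Module.Finite K (PeriodicRing K (k + 1) (l + 1)) ∧
      Module.finrank K (PeriodicRing K (k + 1) (l + 1)) = 3 ^ k * 3 ^ (l + 1) := by
  let m : MonomialOrder (Fin 2) := MonomialOrder.degLex
  have h10 : m.toSyn (Finsupp.single 1 1) < m.toSyn (Finsupp.single 0 1) :=
    MonomialOrder.degLex_single_lt_iff.2 (by decide)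
  have h01 : m.toSyn (Finsupp.single 0 1) < m.toSyn (3 • Finsupp.single 1 1) := by
    rw [MonomialOrder.degLex_lt_iff, Finsupp.DegLex.lt_iff]
    left
    simp
  have hX (i : Fin 2) : m.degree (X i : MvPolynomial (Fin 2) K) = Finsupp.single i 1 := m.degree_X
  have h4 : m.degree (4 * X 1 ^ 3 : MvPolynomial (Fin 2) K) = 3 • Finsupp.single 1 1 := by
    have h0 : (4 : MvPolynomial (Fin 2) K) = C 4 := (map_ofNat C 4).symm
    rw [h0, m.degree_mul (by simp) (by simp), m.degree_C, m.degree_pow, hX, zero_add]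
  have hz : m.degree (4 * X 1 ^ 3 + X 0 : MvPolynomial (Fin 2) K) = 3 • Finsupp.single 1 1 := by
    rw [m.degree_add_of_lt, h4]
    rwa [h4, hX]
  obtain ⟨hP, hP0⟩ := degree_iterate_cubicMap_sub_and_ne_zero (K := K) m (a := X 1) (v := X 0)
    (z := X 0) (y := X 1) (by rwa [hX, hX]) le_rfl le_rfl k
  obtain ⟨hQ, hQ0⟩ := degree_iterate_cubicMap_sub_and_ne_zero (K := K) m (a := X 1) (v := X 0)
    (z := 4 * X 1 ^ 3 + X 0) (y := -X 1) (by rw [hX, hz]; exact h10.trans h01)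
    (by rw [hX, hz]; exact h01.le) (by rw [m.degree_neg]) l
  have := finite_and_finrank_quotient_span_pair (m := m) (M := 3 ^ k) (N := 3 ^ (l + 1))
    (by rw [hP, hX]; simp) (by rw [hQ, hz, smul_smul, ← pow_succ]; simp) hP0 hQ0
    (by positivity) (by positivity)
  rwa [← cubicMap_neg_self, ← Function.iterate_succ_apply (cubicMap _ _),
    show (cubicMap (X 1) (X 0))^[k] (X 0 : MvPolynomial (Fin 2) K) =
      (cubicMap (X 1) (X 0))^[k + 1] (X 1) by
        rw [Function.iterate_succ_apply, cubicMap_self]] at this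

variable {K} in
theorem mem_periodicParameters_iff {p q : ℕ} (w : K × K) :
    w ∈ periodicParameters K p q ↔ ∀ f ∈ periodicIdeal K p q, aeval ![w.2, w.1] f = 0 := by
  have h : (∀ f ∈ periodicIdeal K p q, aeval ![w.2, w.1] f = 0) ↔
      periodicIdeal K p q ≤ RingHom.ker (aeval (R := K) ![w.2, w.1]) := Iff.rfl
  rw [h, periodicIdeal, Ideal.span_le, Set.insert_subset_iff, Set.singleton_subset_iff]
  simp only [SetLike.mem_coe, RingHom.mem_ker, map_sub, map_iterate_cubicMap, map_neg, aeval_X,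
    sub_eq_zero]
  rfl

/-- Points of `periodicParameters` correspond to characters of its coordinate ring. -/
noncomputable def periodicParametersEquiv (p q : ℕ) :
    periodicParameters K p q ≃ (PeriodicRing K p q →ₐ[K] K) where
  toFun w := Ideal.Quotient.liftₐ _ (aeval ![w.1.2, w.1.1]) ((mem_periodicParameters_iff w.1).1 w.2)
  invFun φ := ⟨(φ (Ideal.Quotient.mk _ (X 1)), φ (Ideal.Quotient.mk _ (X 0))), by
    rw [mem_periodicParameters_iff]
    intro f hf
    have : aeval ![φ (Ideal.Quotient.mk _ (X 0)), φ (Ideal.Quotient.mk _ (X 1))] =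
        φ.comp (Ideal.Quotient.mkₐ K (periodicIdeal K p q)) := by
      ext i
      fin_cases i <;> simp
    have h0 : Ideal.Quotient.mk (periodicIdeal K p q) f = 0 := Ideal.Quotient.eq_zero_iff_mem.2 hf
    simp [this, h0]⟩
  left_inv w := by
    ext <;> simp
  right_inv φ := by
    apply Ideal.Quotient.algHom_ext
    ext i
    fin_cases i <;> simp

theorem finite_and_ncard_periodicParameters [CharZero K] [IsAlgClosed K] (k l : ℕ) :
    (periodicParameters K (k + 1) (l + 1)).Finite ∧
      (periodicParameters K (k + 1) (l + 1)).ncard = 3 ^ k * 3 ^ (l + 1) := by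
  obtain ⟨hfin, hrank⟩ := finite_and_finrank_periodicRing K k l
  let π := Ideal.Quotient.mkₐ K (periodicIdeal K (k + 1) (l + 1))
  have hgen : Algebra.adjoin K {π (X 1), π (X 0)} = ⊤ := by
    have h : ({π (X 1), π (X 0)} : Set (PeriodicRing K (k + 1) (l + 1))) = π '' Set.range X := by
      ext x
      simp [Fin.exists_fin_two, eq_comm, or_comm]
    rw [h, ← AlgHom.map_adjoin, adjoin_range_X, Algebra.map_top, AlgHom.range_eq_top]
    exact Ideal.Quotient.mkₐ_surjective K _
  have hp : (cubicMap (π (X 1)) (π (X 0)))^[k + 1] (π (X 1)) = π (X 1) := by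
    rw [← map_iterate_cubicMap]
    exact Ideal.Quotient.eq.2 (Ideal.subset_span (by simp))
  have hq : (cubicMap (π (X 1)) (π (X 0)))^[l + 1] (-π (X 1)) = -π (X 1) := by
    rw [← map_neg, ← map_iterate_cubicMap]
    exact Ideal.Quotient.eq.2 (Ideal.subset_span (by simp))
  have := formallyUnramified_of_iterate_cubicMap_eq hgen hp hq
  have e := periodicParametersEquiv K (k + 1) (l + 1)
  have : Finite (periodicParameters K (k + 1) (l + 1)) := Finite.of_equiv _ e.symm
  refine ⟨Set.toFinite _, ?_⟩
  rw [← Nat.card_coe_set_eq, Nat.card_congr e, natCard_algHom_eq_finrank, hrank]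

end Count

section Inversion

theorem eq_of_sum_divisors_eq {f g : ℕ → ℕ}
    (h : ∀ n, 1 ≤ n → ∑ k ∈ n.divisors, f k = ∑ k ∈ n.divisors, g k) (n : ℕ) (hn : 1 ≤ n) :
    f n = g n := by
  induction n using Nat.strong_induction_on with
  | _ n ih =>
    have h1 := h n hn
    rw [← Nat.cons_self_properDivisors (by omega : n ≠ 0), Finset.sum_cons, Finset.sum_cons,
      Finset.sum_congr rfl fun k hk => ih k (Nat.mem_properDivisors.1 hk).2
        (Nat.pos_of_mem_properDivisors hk)] at h1
    exact Nat.add_right_cancel h1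

theorem eq_of_sum_divisors_sum_divisors_eq {f g : ℕ → ℕ → ℕ}
    (h : ∀ p q, 1 ≤ p → 1 ≤ q → ∑ i ∈ p.divisors, ∑ j ∈ q.divisors, f i j =
      ∑ i ∈ p.divisors, ∑ j ∈ q.divisors, g i j) (p q : ℕ) (hp : 1 ≤ p) (hq : 1 ≤ q) :
    f p q = g p q :=
  eq_of_sum_divisors_eq (f := f p) (g := g p) (fun j hj =>
    eq_of_sum_divisors_eq (f := fun i => ∑ j ∈ j.divisors, f i j)
      (g := fun i => ∑ j ∈ j.divisors, g i j) (fun i hi => h i j hi hj) p hp) q hq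

end Inversion

theorem hasExactPeriod_iff_minimalPeriod {F : ℂ → ℂ} {z : ℂ} {p : ℕ} (hp : 1 ≤ p) :
    HasExactPeriod F z p ↔ minimalPeriod F z = p := by
  constructor
  · rintro ⟨h1, h2⟩
    have hper : IsPeriodicPt F p z := h1
    refine le_antisymm (hper.minimalPeriod_le hp) (not_lt.1 fun hlt => ?_)
    exact h2 _ (hper.minimalPeriod_pos hp) hlt (isPeriodicPt_minimalPeriod F z)
  · rintro rfl
    exact ⟨isPeriodicPt_minimalPeriod F z, fun j hj hlt h =>
      not_isPeriodicPt_of_pos_of_lt_minimalPeriod hj.ne' hlt h⟩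

/-- The parameters for which `a` has minimal period `p` and `-a` has minimal period `q`. -/
def exactParameters (p q : ℕ) : Set (ℂ × ℂ) :=
  {w | minimalPeriod (cubicMap w.1 w.2) w.1 = p ∧ minimalPeriod (cubicMap w.1 w.2) (-w.1) = q}

theorem exactParameters_subset (p q : ℕ) : exactParameters p q ⊆ periodicParameters ℂ p q := by
  rintro w ⟨rfl, rfl⟩
  exact ⟨isPeriodicPt_minimalPeriod _ _, isPeriodicPt_minimalPeriod _ _⟩

theorem finite_periodicParameters {p q : ℕ} (hp : 1 ≤ p) (hq : 1 ≤ q) :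
    (periodicParameters ℂ p q).Finite := by
  obtain ⟨k, rfl⟩ := Nat.exists_eq_add_of_le' hp
  obtain ⟨l, rfl⟩ := Nat.exists_eq_add_of_le' hq
  exact (finite_and_ncard_periodicParameters ℂ k l).1

theorem sum_ncard_exactParameters {p q : ℕ} (hp : 1 ≤ p) (hq : 1 ≤ q) :
    ∑ i ∈ p.divisors, ∑ j ∈ q.divisors, (exactParameters i j).ncard =
      3 ^ (p - 1) * 3 ^ q := by
  have hfin := finite_periodicParameters hp hq
  have hcard : (periodicParameters ℂ p q).ncard = 3 ^ (p - 1) * 3 ^ q := by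
    obtain ⟨k, rfl⟩ := Nat.exists_eq_add_of_le' hp
    obtain ⟨l, rfl⟩ := Nat.exists_eq_add_of_le' hq
    exact (finite_and_ncard_periodicParameters ℂ k l).2
  rw [← hcard, Set.ncard_eq_toFinset_card _ hfin, ← Finset.sum_product',
    Finset.card_eq_sum_card_fiberwise (t := p.divisors ×ˢ q.divisors)
      (f := fun w => (minimalPeriod (cubicMap w.1 w.2) w.1,
        minimalPeriod (cubicMap w.1 w.2) (-w.1)))]
  · refine Finset.sum_congr rfl fun ij hij => ?_
    rw [← Set.ncard_coe_finset]
    congr 1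
    ext w
    rw [Finset.mem_product, Nat.mem_divisors, Nat.mem_divisors] at hij
    simp only [Finset.coe_filter, Set.Finite.mem_toFinset, Set.mem_ofPred_eq, exactParameters,
      Prod.ext_iff]
    refine ⟨fun h => ⟨⟨?_, ?_⟩, h⟩, fun h => h.2⟩
    · exact isPeriodicPt_iff_minimalPeriod_dvd.2 (h.1 ▸ hij.1.1)
    · exact isPeriodicPt_iff_minimalPeriod_dvd.2 (h.2 ▸ hij.2.1)
  · intro w hw
    have hw' : w ∈ periodicParameters ℂ p q := by simpa using hw
    simp only [Finset.coe_product, Set.mem_prod, Finset.mem_coe, Nat.mem_divisors]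
    exact ⟨⟨isPeriodicPt_iff_minimalPeriod_dvd.1 hw'.1, by omega⟩,
      ⟨isPeriodicPt_iff_minimalPeriod_dvd.1 hw'.2, by omega⟩⟩

theorem stmt1 (d : ℕ → ℕ) (hd : ∀ n : ℕ, 1 ≤ n → ∑ k ∈ n.divisors, d k = 3 ^ (n - 1))
    (p q : ℕ) (hp : 1 ≤ p) (hq : 1 ≤ q) :
    let D : Set (ℂ × ℂ) := {w | HasExactPeriod (Fav w.1 w.2) w.1 p ∧
      HasExactPeriod (Fav w.1 w.2) (-w.1) q}
    D.Finite ∧ D.ncard = 3 * d q * d p := by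
  intro D
  have hD : D = exactParameters p q := by
    ext w
    exact and_congr (hasExactPeriod_iff_minimalPeriod hp) (hasExactPeriod_iff_minimalPeriod hq)
  rw [hD]
  refine ⟨(finite_periodicParameters hp hq).subset (exactParameters_subset p q), ?_⟩
  refine eq_of_sum_divisors_sum_divisors_eq (f := fun i j => (exactParameters i j).ncard)
    (g := fun i j => 3 * d j * d i) (fun p q hp hq => ?_) p q hp hq
  rw [sum_ncard_exactParameters hp hq]
  simp_rw [← Finset.sum_mul, ← Finset.mul_sum]
  rw [hd p hp, hd q hq, ← pow_succ', Nat.sub_add_cancel hq, mul_comm]
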